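/- Let 1 ≤ p < q ≤ ∞, set α = 1/p − 1/q (with the convention 1/∞ = 0), and let m, n ∈ ℕ with m ≤ n. Let X, Y be Banach spaces, T₀ a bounded linear operator from X to Y, and let T : ℓ_p^m(X) → ℓ_q^m(Y) be the diagonal operator T(x₁, …, x_m) = (T₀(x₁), …, T₀(x_m)). For a > 0 put D(a,n,m) = max over k ∈ {1,…,n} with k ≥ a of (k/n)^α·e_k(T₀). Then there exist absolute constants c₃, c₄ > 0 and positive constants c₅, c₆ depending only on p and q such that c₅·D(c₃·n/m, n, m) ≤ e_n(T) ≤ c₆·D(c₄·n/m, n, m). -/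

import Mathlib

open Metric Set
open scoped ENNReal

/-- The `n`-th (dyadic) entropy number of a bounded linear operator `T : X → Y`:
the infimum of all `ε > 0` such that the image of the closed unit ball of `X`
can be covered by `2 ^ (n - 1)` closed balls of radius `ε` in `Y`. -/
noncomputable def entropyNum {X Y : Type*} [NormedAddCommGroup X] [NormedSpace ℝ X]
    [NormedAddCommGroup Y] [NormedSpace ℝ Y] (n : ℕ) (T : X →L[ℝ] Y) : ℝ :=
  sInf {ε : ℝ | 0 < ε ∧ ∃ S : Finset Y, S.card ≤ 2 ^ (n - 1) ∧
    T '' closedBall 0 1 ⊆ ⋃ y ∈ S, closedBall y ε}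

/-- The `n`-th (dyadic) inner entropy number of a bounded linear operator `T : X → Y`:
the supremum of all `ε > 0` such that there are `2 ^ (n - 1) + 1` points in the closed
unit ball of `X` whose images under `T` are pairwise at distance at least `2 * ε`. -/
noncomputable def innerEntropyNum {X Y : Type*} [NormedAddCommGroup X] [NormedSpace ℝ X]
    [NormedAddCommGroup Y] [NormedSpace ℝ Y] (n : ℕ) (T : X →L[ℝ] Y) : ℝ :=
  sSup {ε : ℝ | 0 < ε ∧ ∃ x : Fin (2 ^ (n - 1) + 1) → X, (∀ i, ‖x i‖ ≤ 1) ∧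
    ∀ i j, i ≠ j → 2 * ε ≤ ‖T (x i) - T (x j)‖}

section EntropyNumbers

variable {X Y : Type*} [NormedAddCommGroup X] [NormedSpace ℝ X]
  [NormedAddCommGroup Y] [NormedSpace ℝ Y]

theorem entropyNum_nonneg (n : ℕ) (T : X →L[ℝ] Y) : 0 ≤ entropyNum n T :=
  Real.sInf_nonneg fun _ h => h.1.le

theorem entropyNum_le {n : ℕ} {T : X →L[ℝ] Y} {ε : ℝ} (hε : 0 < ε) (S : Finset Y)
    (hS : S.card ≤ 2 ^ (n - 1)) (h : ∀ x, ‖x‖ ≤ 1 → ∃ y ∈ S, ‖T x - y‖ ≤ ε) :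
    entropyNum n T ≤ ε := by
  refine csInf_le ⟨0, fun _ h => h.1.le⟩ ⟨hε, S, hS, ?_⟩
  rintro _ ⟨x, hx, rfl⟩
  obtain ⟨y, hy, hxy⟩ := h x (by simpa using hx)
  simp only [mem_iUnion]
  exact ⟨y, hy, by rwa [mem_closedBall, dist_eq_norm]⟩

theorem exists_cover_of_entropyNum_lt {n : ℕ} {T : X →L[ℝ] Y} {ε : ℝ}
    (h : entropyNum n T < ε) :
    ∃ S : Finset Y, S.card ≤ 2 ^ (n - 1) ∧ ∀ x, ‖x‖ ≤ 1 → ∃ y ∈ S, ‖T x - y‖ ≤ ε := by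
  have hne : {ε : ℝ | 0 < ε ∧ ∃ S : Finset Y, S.card ≤ 2 ^ (n - 1) ∧
      T '' closedBall 0 1 ⊆ ⋃ y ∈ S, closedBall y ε}.Nonempty := by
    refine ⟨‖T‖ + 1, by positivity, {0}, by simpa using Nat.one_le_two_pow, ?_⟩
    rintro _ ⟨x, hx, rfl⟩
    have hx' : ‖x‖ ≤ 1 := by simpa using hx
    have := T.le_opNorm_of_le hx'
    simp only [Finset.mem_singleton, iUnion_iUnion_eq_left, mem_closedBall, dist_zero_right]
    linarith
  obtain ⟨δ, ⟨-, S, hS, hcov⟩, hδ⟩ := exists_lt_of_csInf_lt hne h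
  refine ⟨S, hS, fun x hx => ?_⟩
  have := hcov ⟨x, by simpa using hx, rfl⟩
  simp only [mem_iUnion] at this
  obtain ⟨y, hy, hxy⟩ := this
  rw [mem_closedBall, dist_eq_norm] at hxy
  exact ⟨y, hy, hxy.trans hδ.le⟩

/-- Below the entropy number, separated families of `2 ^ (n - 1)` points exist. -/
theorem exists_separated_of_lt_entropyNum {n : ℕ} {T : X →L[ℝ] Y} {s : ℝ} (hs : 0 < s)
    (h : s < entropyNum n T) :
    ∃ U : Finset X, U.card = 2 ^ (n - 1) ∧ (∀ x ∈ U, ‖x‖ ≤ 1) ∧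
      ∀ x ∈ U, ∀ y ∈ U, x ≠ y → s ≤ ‖T x - T y‖ := by
  classical
  suffices H : ∀ N ≤ 2 ^ (n - 1), ∃ U : Finset X, U.card = N ∧ (∀ x ∈ U, ‖x‖ ≤ 1) ∧
      ∀ x ∈ U, ∀ y ∈ U, x ≠ y → s ≤ ‖T x - T y‖ from H _ le_rfl
  intro N
  induction N with
  | zero => exact fun _ => ⟨∅, by simp⟩
  | succ N ih =>
    intro hN
    obtain ⟨U, hcard, hball, hsep⟩ := ih (by omega)
    obtain ⟨x, hx, hfar⟩ : ∃ x, ‖x‖ ≤ 1 ∧ ∀ y ∈ U, s < ‖T x - T y‖ := by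
      by_contra! hcon
      refine h.not_ge (entropyNum_le hs (U.image T) ?_ fun x hx => ?_)
      · exact Finset.card_image_le.trans (by omega)
      · obtain ⟨y, hy, hxy⟩ := hcon x hx
        exact ⟨T y, Finset.mem_image_of_mem _ hy, hxy⟩
    have hxU : x ∉ U := fun hxU => by
      have := hfar x hxU
      simp only [sub_self, norm_zero] at this
      linarith
    refine ⟨insert x U, by rw [Finset.card_insert_of_notMem hxU, hcard], ?_, ?_⟩
    · simpa [hx] using hball
    · intro a ha b hb hab
      rw [Finset.mem_insert] at ha hb
      rcases ha with rfl | ha <;> rcases hb with rfl | hb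
      · exact absurd rfl hab
      · exact (hfar b hb).le
      · rw [norm_sub_rev]
        exact (hfar a ha).le
      · exact hsep a ha b hb hab

/-- Points on a segment give `N` separated points at distance comparable to any entropy
number. -/
theorem exists_separated_on_segment {n N : ℕ} {T : X →L[ℝ] Y} {s : ℝ} (hN : 0 < N) (hs : 0 < s)
    (h : N * s < entropyNum n T) :
    ∃ x : Fin N → X, (∀ i, ‖x i‖ ≤ 1) ∧ ∀ i j, i ≠ j → s ≤ ‖T (x i) - T (x j)‖ := by
  have hN' : (0 : ℝ) < N := by exact_mod_cast hN
  obtain ⟨x, hx, hfar⟩ : ∃ x, ‖x‖ ≤ 1 ∧ N * s < ‖T x‖ := by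
    by_contra! hcon
    refine h.not_ge (entropyNum_le (by positivity) {0} (by simpa using Nat.one_le_two_pow)
      fun x hx => ⟨0, by simp, ?_⟩)
    simpa using hcon x hx
  refine ⟨fun i => ((i : ℝ) / N) • x, fun i => ?_, fun i j hij => ?_⟩
  · have hi : (i : ℝ) ≤ N := by exact_mod_cast i.2.le
    rw [norm_smul, Real.norm_of_nonneg (by positivity)]
    exact mul_le_one₀ ((div_le_one hN').2 hi) (norm_nonneg _) hx
  · have hij' : (1 : ℝ) ≤ |(i : ℝ) - j| := by
      have : (1 : ℤ) ≤ |(i : ℤ) - j| := Int.one_le_abs (by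
        have : (i : ℕ) ≠ j := fun h => hij (Fin.ext h)
        omega)
      exact_mod_cast this
    rw [map_smul, map_smul, ← sub_smul, norm_smul, ← sub_div, Real.norm_eq_abs, abs_div,
      abs_of_pos hN', div_mul_eq_mul_div, le_div_iff₀ hN']
    nlinarith [norm_nonneg (T x)]

end EntropyNumbers

section Counting

/-- A Hamming ball of radius `d` in `ι ^ l` has at most `2 ^ l * (card ι) ^ d` elements,
stated without division for subsets of the ball. -/
theorem card_hamming_ball_mul_le {ι : Type*} [Fintype ι] [DecidableEq ι] {l d : ℕ}
    (z₀ : Fin l → ι) (P : Finset (Fin l → ι)) (hP : ∀ z ∈ P, hammingDist z z₀ ≤ d) :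
    P.card * Fintype.card ι ^ (l - d) ≤ (2 * Fintype.card ι) ^ l := by
  set A := Fintype.card ι
  have hsum : ∑ z : Fin l → ι, ∏ i, (if z i = z₀ i then A else 1) ≤ (2 * A) ^ l := by
    rw [← Fintype.prod_sum fun (i : Fin l) (a : ι) => if a = z₀ i then A else 1]
    calc ∏ i : Fin l, ∑ a : ι, (if a = z₀ i then A else 1)
        ≤ ∏ _i : Fin l, 2 * A := by
          refine Finset.prod_le_prod' fun i _ => ?_
          calc ∑ a : ι, (if a = z₀ i then A else 1)
              ≤ ∑ a : ι, ((if a = z₀ i then A else 0) + 1) :=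
                Finset.sum_le_sum fun a _ => by split_ifs <;> omega
            _ = 2 * A := by
              rw [Finset.sum_add_distrib, Finset.sum_ite_eq' Finset.univ (z₀ i)]
              simp [A]
              omega
      _ = (2 * A) ^ l := by simp
  refine le_trans ?_ hsum
  refine le_trans ?_ (Finset.sum_le_sum_of_subset (Finset.subset_univ P))
  rw [← smul_eq_mul]
  refine Finset.card_nsmul_le_sum _ _ _ fun z hz => ?_
  have hA : 0 < A ∨ l = 0 := by
    rcases Nat.eq_zero_or_pos l with h | h
    · exact Or.inr h
    · exact Or.inl (Fintype.card_pos_iff.2 ⟨z₀ ⟨0, h⟩⟩)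
  rcases hA with hA | rfl
  · rw [Finset.prod_ite, Finset.prod_const, Finset.prod_const_one, mul_one]
    refine Nat.pow_le_pow_right hA ?_
    have h₁ := hP z hz
    have h₂ := Finset.card_filter_add_card_filter_not (s := Finset.univ) fun i => z i = z₀ i
    simp only [Finset.card_univ, Fintype.card_fin] at h₂
    unfold hammingDist at h₁
    simp only [ne_eq] at h₁
    omega
  · simp

/-- The lattice points of the simplex `∑ bᵢ ≤ N`, `b ∈ ℕ ^ m`. -/
def latticeSimplex (m N : ℕ) : Finset (Fin m → ℕ) :=
  {b ∈ Fintype.piFinset fun _ => Finset.range (N + 1) | ∑ i, b i ≤ N}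

theorem mem_latticeSimplex {m N : ℕ} {b : Fin m → ℕ} :
    b ∈ latticeSimplex m N ↔ ∑ i, b i ≤ N := by
  simp only [latticeSimplex, Finset.mem_filter, Fintype.mem_piFinset, Finset.mem_range,
    and_iff_right_iff_imp]
  intro h i
  exact Nat.lt_succ_of_le ((Finset.single_le_sum (fun _ _ => Nat.zero_le _)
    (Finset.mem_univ i)).trans h)

theorem card_latticeSimplex_le (m N : ℕ) :
    ((latticeSimplex m N).card : ℝ) ≤ 4 ^ N * (4 / 3) ^ m := by
  have hsum : ∑ b ∈ Fintype.piFinset fun _ : Fin m => Finset.range (N + 1),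
      ∏ i, (1 / 4 : ℝ) ^ b i ≤ (4 / 3) ^ m := by
    rw [Finset.sum_prod_piFinset (Finset.range (N + 1)) fun _ j => (1 / 4 : ℝ) ^ j,
      Finset.prod_const, Finset.card_univ, Fintype.card_fin]
    refine pow_le_pow_left₀ (Finset.sum_nonneg fun _ _ => by positivity) ?_ _
    rw [geom_sum_eq (by norm_num)]
    have : (0 : ℝ) < (1 / 4) ^ (N + 1) := by positivity
    rw [div_le_iff_of_neg (by norm_num)]
    linarith
  have hcard : ((latticeSimplex m N).card : ℝ) * (1 / 4) ^ N ≤ (4 / 3) ^ m := by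
    refine le_trans ?_ hsum
    refine le_trans ?_ (Finset.sum_le_sum_of_subset_of_nonneg
      (Finset.filter_subset (fun b => ∑ i, b i ≤ N) _) fun _ _ _ => by positivity)
    rw [← nsmul_eq_mul]
    refine Finset.card_nsmul_le_sum _ _ _ fun b hb => ?_
    rw [Finset.prod_pow_eq_pow_sum]
    exact pow_le_pow_of_le_one (by norm_num) (by norm_num) (mem_latticeSimplex.1 hb)
  have h4 : (4 : ℝ) ^ N * (1 / 4) ^ N = 1 := by rw [← mul_pow]; norm_num
  calc ((latticeSimplex m N).card : ℝ)
      = 4 ^ N * ((latticeSimplex m N).card * (1 / 4) ^ N) := by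
        rw [mul_left_comm, h4, mul_one]
    _ ≤ _ := by gcongr

theorem card_latticeSimplex_mul_two_pow_le {m n : ℕ} (hmn : m ≤ n) :
    (latticeSimplex m (n / 16)).card * 2 ^ (2 * (n / 16)) ≤ 2 ^ (n - 1) := by
  rcases lt_or_ge n 16 with hn | hn
  · have hN : n / 16 = 0 := Nat.div_eq_of_lt hn
    rw [hN]
    have : (latticeSimplex m 0).card ≤ 1 := by
      refine Finset.card_le_one.2 fun a ha b hb => ?_
      rw [mem_latticeSimplex, Nat.le_zero, Finset.sum_eq_zero_iff] at ha hb
      funext i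
      rw [ha i (Finset.mem_univ i), hb i (Finset.mem_univ i)]
    simpa using this.trans Nat.one_le_two_pow
  · set N := n / 16
    have hN : 8 * N + m ≤ 2 * (n - 1) := by omega
    have h := card_latticeSimplex_le m N
    have hsq : ((latticeSimplex m N).card * 2 ^ (2 * N) : ℝ) ^ 2 ≤ (2 ^ (n - 1)) ^ 2 := by
      calc ((latticeSimplex m N).card * 2 ^ (2 * N) : ℝ) ^ 2
          ≤ (4 ^ N * (4 / 3) ^ m * 2 ^ (2 * N)) ^ 2 := by gcongr
        _ = 2 ^ (8 * N) * (16 / 9) ^ m := by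
          rw [show (4 : ℝ) = 2 ^ 2 by norm_num, mul_pow, mul_pow, ← pow_mul, ← pow_mul, ← pow_mul,
            ← pow_mul, mul_comm m 2, pow_mul _ 2 m, mul_right_comm, ← pow_add]
          norm_num
          ring
        _ ≤ 2 ^ (8 * N) * 2 ^ m := by gcongr; norm_num
        _ = 2 ^ (8 * N + m) := by rw [pow_add]
        _ ≤ 2 ^ (2 * (n - 1)) := pow_le_pow_right₀ (by norm_num) hN
        _ = (2 ^ (n - 1)) ^ 2 := by rw [mul_comm, pow_mul]
    exact_mod_cast (pow_le_pow_iff_left₀ (by positivity) (by positivity) two_ne_zero).1 hsq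

end Counting

section PiLpNorms

variable {Y : Type*} [NormedAddCommGroup Y] {q : ℝ≥0∞} [Fact (1 ≤ q)]

theorem PiLp.norm_le_of_forall_norm_le_rpow {m : ℕ} {z : PiLp q fun _ : Fin m => Y}
    {σ : Fin m → ℝ} {C R : ℝ} (hC : 0 ≤ C) (hσ : ∀ i, 0 ≤ σ i) (hR : ∑ i, σ i ≤ R)
    (h : ∀ i, ‖z i‖ ≤ C * σ i ^ (1 / q.toReal)) : ‖z‖ ≤ C * R ^ (1 / q.toReal) := by
  have hR0 : 0 ≤ R := (Finset.sum_nonneg fun i _ => hσ i).trans hR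
  rcases eq_or_ne q ∞ with rfl | hq
  · rw [PiLp.norm_eq_ciSup]
    refine Real.iSup_le (fun i => by simpa using h i) (by positivity)
  · have hq0 : 0 < q.toReal := ENNReal.toReal_pos (zero_lt_one.trans_le Fact.out).ne' hq
    rw [PiLp.norm_eq_sum hq0, one_div, Real.rpow_inv_le_iff_of_pos (by positivity) (by positivity)
      hq0, Real.mul_rpow hC (by positivity), Real.rpow_inv_rpow hR0 hq0.ne']
    calc ∑ i, ‖z i‖ ^ q.toReal ≤ ∑ i, C ^ q.toReal * σ i := by
          refine Finset.sum_le_sum fun i _ => ?_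
          rw [← Real.rpow_inv_rpow (hσ i) hq0.ne', ← Real.mul_rpow hC (by have := hσ i; positivity)]
          exact Real.rpow_le_rpow (norm_nonneg _) (by simpa using h i) hq0.le
      _ ≤ C ^ q.toReal * R := by rw [← Finset.mul_sum]; gcongr

theorem PiLp.card_rpow_mul_le_norm {m : ℕ} {z : PiLp q fun _ : Fin m => Y}
    {s : ℝ} (hs : 0 ≤ s) (J : Finset (Fin m)) (hJ : J.Nonempty) (h : ∀ i ∈ J, s ≤ ‖z i‖) :
    (J.card : ℝ) ^ (1 / q.toReal) * s ≤ ‖z‖ := by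
  rcases eq_or_ne q ∞ with rfl | hq
  · obtain ⟨i, hi⟩ := hJ
    simpa using (h i hi).trans (PiLp.norm_apply_le z i)
  · have hq0 : 0 < q.toReal := ENNReal.toReal_pos (zero_lt_one.trans_le Fact.out).ne' hq
    rw [PiLp.norm_eq_sum hq0, one_div, Real.le_rpow_inv_iff_of_pos (by positivity)
      (by positivity) hq0, Real.mul_rpow (by positivity) hs, Real.rpow_inv_rpow (by positivity)
      hq0.ne', ← nsmul_eq_mul]
    calc J.card • s ^ q.toReal ≤ ∑ i ∈ J, ‖z i‖ ^ q.toReal :=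
          Finset.card_nsmul_le_sum _ _ _ fun i hi => Real.rpow_le_rpow hs (h i hi) hq0.le
      _ ≤ ∑ i, ‖z i‖ ^ q.toReal :=
          Finset.sum_le_sum_of_subset_of_nonneg (Finset.subset_univ J) fun _ _ _ => by positivity

end PiLpNorms

section Diagonal

variable {X Y : Type*} [NormedAddCommGroup X] [NormedSpace ℝ X]
  [NormedAddCommGroup Y] [NormedSpace ℝ Y] {p q : ℝ≥0∞} [Fact (1 ≤ p)] [Fact (1 ≤ q)]

/-- Among the words of length `l` over an alphabet of `2 ^ K` letters, any colouring with
`2 ^ (n - 1)` colours has two words of the same colour which differ in more than half of the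
places, provided `2 * n + 2 * l ≤ K * l`. -/
theorem exists_same_color_half_lt_hammingDist {ι κ : Type*} [Fintype ι] [DecidableEq ι]
    {K l n : ℕ} (hcard : Fintype.card ι = 2 ^ K) (hn : 1 ≤ n) (hl : 2 * n + 2 * l ≤ K * l)
    (S : Finset κ) (hS : S.card ≤ 2 ^ (n - 1)) (c : (Fin l → ι) → κ) (hc : ∀ z, c z ∈ S) :
    ∃ z w, c z = c w ∧ l / 2 < hammingDist z w := by
  classical
  by_contra! hcon
  have hfib : ∀ y ∈ S, (Finset.univ.filter fun z => c z = y).card * 2 ^ (K * (l - l / 2)) ≤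
      2 ^ ((K + 1) * l) := by
    intro y _
    rcases (Finset.univ.filter fun z => c z = y).eq_empty_or_nonempty with h | ⟨z₀, hz₀⟩
    · simp [h]
    · have := card_hamming_ball_mul_le (d := l / 2) z₀ (Finset.univ.filter fun z => c z = y)
        fun z hz => hcon z z₀ (by simp_all)
      rwa [hcard, ← pow_mul, ← pow_succ', ← pow_mul] at this
  have htot : 2 ^ (K * l) * 2 ^ (K * (l - l / 2)) ≤ 2 ^ (n - 1) * 2 ^ ((K + 1) * l) := by
    have h := Finset.card_eq_sum_card_fiberwise (s := Finset.univ) (t := S) (f := c)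
      fun z _ => hc z
    rw [Finset.card_univ, Fintype.card_fun, hcard, Fintype.card_fin, ← pow_mul] at h
    rw [h, Finset.sum_mul]
    calc _ ≤ ∑ _y ∈ S, 2 ^ ((K + 1) * l) := Finset.sum_le_sum hfib
      _ ≤ _ := by
        rw [Finset.sum_const, smul_eq_mul]
        gcongr
  rw [← pow_add, ← pow_add, Nat.pow_le_pow_iff_right (by norm_num)] at htot
  have h2 : K * l ≤ 2 * (K * (l - l / 2)) := by
    calc K * l ≤ K * (2 * (l - l / 2)) := Nat.mul_le_mul_left _ (by omega)
      _ = _ := by ring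
  rw [add_mul, one_mul] at htot
  omega

theorem le_entropyNum_diagonal_of_separated {ι : Type*} [Fintype ι] {K l m n : ℕ}
    {T₀ : X →L[ℝ] Y} {T : PiLp p (fun _ : Fin m => X) →L[ℝ] PiLp q (fun _ : Fin m => Y)}
    (hT : ∀ x i, T x i = T₀ (x i)) (hcard : Fintype.card ι = 2 ^ K) (hn : 1 ≤ n) (hl0 : 0 < l)
    (hlm : l ≤ m) (hl : 2 * n + 2 * l ≤ K * l) {s : ℝ} (hs : 0 ≤ s) (x : ι → X)
    (hx : ∀ i, ‖x i‖ ≤ 1) (hsep : ∀ i j, i ≠ j → s ≤ ‖T₀ (x i) - T₀ (x j)‖) :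
    s / 4 * (l : ℝ) ^ (-(1 / p.toReal - 1 / q.toReal)) ≤ entropyNum n T := by
  classical
  refine le_of_forall_gt fun ε hε => ?_
  obtain ⟨δ, hδ, hδε⟩ := exists_between hε
  obtain ⟨S, hS, hcov⟩ := exists_cover_of_entropyNum_lt hδ
  refine lt_of_le_of_lt ?_ hδε
  have hl' : (0 : ℝ) < l := by exact_mod_cast hl0
  set ρ : ℝ := (l : ℝ)⁻¹ ^ (1 / p.toReal) with hρ
  have hρ0 : 0 < ρ := by positivity
  let v : (Fin l → ι) → PiLp p (fun _ : Fin m => X) := fun z =>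
    WithLp.toLp p fun i => if h : (i : ℕ) < l then ρ • x (z ⟨i, h⟩) else 0
  have hv : ∀ z, ‖v z‖ ≤ 1 := by
    intro z
    have := PiLp.norm_le_of_forall_norm_le_rpow (z := v z) (C := 1) (R := 1)
      (σ := fun i => if (i : ℕ) < l then (l : ℝ)⁻¹ else 0) zero_le_one
      (fun i => by positivity) ?_ fun i => ?_
    · simpa using this
    · rw [Finset.sum_ite, Finset.sum_const_zero, add_zero, Finset.sum_const, nsmul_eq_mul,
        ← div_eq_mul_inv, div_le_one hl']
      have : (Finset.univ.filter fun i : Fin m => (i : ℕ) < l).card ≤ l := by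
        rw [Fin.card_filter_val_lt]
        exact min_le_right _ _
      exact_mod_cast this
    · by_cases h : (i : ℕ) < l
      · simp only [v, h, dite_true, if_true, norm_smul, one_mul, Real.norm_of_nonneg hρ0.le]
        exact mul_le_of_le_one_right hρ0.le (hx _)
      · simp only [v, h, dite_false, if_false, norm_zero, one_mul]
        positivity
  choose c hcS hc using fun z => hcov (v z) (hv z)
  obtain ⟨z, w, hzw, hham⟩ := exists_same_color_half_lt_hammingDist hcard hn hl S hS c hcS
  have hclose : ‖T (v z) - T (v w)‖ ≤ 2 * δ := by
    have h₁ := hc z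
    have h₂ := hc w
    rw [← hzw, norm_sub_rev] at h₂
    have := norm_sub_le_norm_sub_add_norm_sub (T (v z)) (c z) (T (v w))
    linarith
  set J : Finset (Fin m) := (Finset.univ.filter fun i => z i ≠ w i).map (Fin.castLEEmb hlm)
  have hJcard : J.card = hammingDist z w := Finset.card_map _
  have hfar := PiLp.card_rpow_mul_le_norm (z := T (v z) - T (v w)) (s := ρ * s) (by positivity) J
    (Finset.card_pos.1 (by omega)) fun i hi => by
      obtain ⟨j, hj, rfl⟩ := Finset.mem_map.1 hi
      have hjl : ((Fin.castLEEmb hlm j : Fin m) : ℕ) < l := j.2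
      rw [PiLp.sub_apply, hT, hT, ← map_sub]
      simp only [v, hjl, dite_true]
      rw [← smul_sub, map_smul, norm_smul, Real.norm_of_nonneg hρ0.le, map_sub]
      exact mul_le_mul_of_nonneg_left (hsep _ _ (Finset.mem_filter.1 hj).2) hρ0.le
  have hJ2 : (l : ℝ) / 2 ≤ J.card := by
    have : l ≤ 2 * J.card := by omega
    have : (l : ℝ) ≤ 2 * J.card := by exact_mod_cast this
    linarith
  have hq1 : 1 / q.toReal ≤ 1 := by
    rcases eq_or_ne q ∞ with rfl | hq
    · simp
    · have : 1 ≤ q.toReal := by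
        simpa using ENNReal.toReal_mono hq (Fact.out : 1 ≤ q)
      exact (div_le_one (by linarith)).2 this
  have hq0 : 0 ≤ 1 / q.toReal := by positivity
  have hpow : (l : ℝ) ^ (1 / q.toReal) / 2 ≤ (J.card : ℝ) ^ (1 / q.toReal) := by
    calc (l : ℝ) ^ (1 / q.toReal) / 2 ≤ (l : ℝ) ^ (1 / q.toReal) / 2 ^ (1 / q.toReal) := by
          gcongr
          simpa using Real.rpow_le_rpow_of_exponent_le one_le_two hq1
      _ = ((l : ℝ) / 2) ^ (1 / q.toReal) := (Real.div_rpow hl'.le zero_le_two _).symm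
      _ ≤ _ := by gcongr
  have hsplit : (l : ℝ) ^ (-(1 / p.toReal - 1 / q.toReal)) = (l : ℝ) ^ (1 / q.toReal) * ρ := by
    rw [hρ, Real.inv_rpow hl'.le, ← Real.rpow_neg hl'.le, ← Real.rpow_add hl']
    ring_nf
  have : (l : ℝ) ^ (1 / q.toReal) / 2 * (ρ * s) ≤ 2 * δ :=
    (mul_le_mul_of_nonneg_right hpow (by positivity)).trans (hfar.trans hclose)
  rw [hsplit]
  linarith

theorem rpow_mul_entropyNum_le_entropyNum_diagonal {k m n : ℕ}
    {T₀ : X →L[ℝ] Y} {T : PiLp p (fun _ : Fin m => X) →L[ℝ] PiLp q (fun _ : Fin m => Y)}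
    (hT : ∀ x i, T x i = T₀ (x i)) (hα : 0 ≤ 1 / p.toReal - 1 / q.toReal) (hk : 1 ≤ k)
    (hkn : k ≤ n) (hkm : 4 * n ≤ k * m) :
    5 ^ (-(1 / p.toReal - 1 / q.toReal)) / 256 *
      (((k : ℝ) / n) ^ (1 / p.toReal - 1 / q.toReal) * entropyNum k T₀) ≤ entropyNum n T := by
  set α := 1 / p.toReal - 1 / q.toReal
  rcases (entropyNum_nonneg k T₀).eq_or_lt with he | he
  · rw [← he]
    simpa using entropyNum_nonneg n T
  set e := entropyNum k T₀ with hedef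
  obtain ⟨l, hl1, hl2, hlm⟩ : ∃ l, 4 * n ≤ k * l ∧ k * l ≤ 5 * n ∧ l ≤ m := by
    refine ⟨(4 * n + (k - 1)) / k, ?_, ?_, ?_⟩
    · have := Nat.lt_mul_div_succ (4 * n + (k - 1)) (show 0 < k by omega)
      rw [mul_add, mul_one] at this
      omega
    · have := Nat.mul_div_le (4 * n + (k - 1)) k
      omega
    · refine Nat.lt_succ_iff.1 ((Nat.div_lt_iff_lt_mul (by omega)).2 ?_)
      rw [mul_comm m.succ, Nat.mul_succ]
      omega
  have hl0 : 0 < l := Nat.pos_of_ne_zero fun h => by simp [h] at hl1; omega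
  have hn : 1 ≤ n := hk.trans hkn
  have hk' : (0 : ℝ) < k := by exact_mod_cast hk
  have hn' : (0 : ℝ) < n := by exact_mod_cast hn
  have hl' : (0 : ℝ) < l := by exact_mod_cast hl0
  have main : e / 64 / 4 * (l : ℝ) ^ (-α) ≤ entropyNum n T := by
    rcases le_or_gt 6 k with h6 | h6
    · obtain ⟨U, hU, hball, hsep⟩ := exists_separated_of_lt_entropyNum (n := k) (T := T₀)
        (s := e / 64) (by positivity) (by rw [← hedef]; linarith)
      refine le_entropyNum_diagonal_of_separated (ι := U) (K := k - 1) hT (by simpa using hU) hn hl0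
        hlm ?_ (by positivity) (fun u => (u : X)) (fun u => hball u u.2)
        fun u w h => hsep u u.2 w w.2 fun h' => h (Subtype.ext h')
      obtain ⟨j, rfl⟩ := Nat.exists_eq_add_of_le h6
      rw [show 6 + j - 1 = 5 + j by omega]
      nlinarith
    · obtain ⟨x, hball, hsep⟩ := exists_separated_on_segment (n := k) (N := 2 ^ 5) (T := T₀)
        (s := e / 64) (by norm_num) (by positivity) (by rw [← hedef]; push_cast; linarith)
      refine le_entropyNum_diagonal_of_separated (K := 5) hT (by simp) hn hl0
        hlm ?_ (by positivity) x hball hsep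
      have : k * l ≤ 5 * l := Nat.mul_le_mul_right _ (by omega)
      omega
  have hlk : (l : ℝ) ≤ 5 * (n / k) := by
    have : (k : ℝ) * l ≤ 5 * n := by exact_mod_cast hl2
    rw [← mul_div_assoc, le_div_iff₀ hk']
    linarith
  have hpow : 5 ^ (-α) * ((k : ℝ) / n) ^ α ≤ (l : ℝ) ^ (-α) := by
    calc 5 ^ (-α) * ((k : ℝ) / n) ^ α = (5 * ((n : ℝ) / k)) ^ (-α) := by
          rw [Real.mul_rpow (by norm_num) (by positivity), Real.rpow_neg (x := (n : ℝ) / k)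
            (by positivity), ← Real.inv_rpow (by positivity), inv_div]
      _ ≤ _ := Real.rpow_le_rpow_of_nonpos hl' hlk (by linarith)
  refine le_trans ?_ main
  nlinarith

theorem entropyNum_diagonal_le {m n : ℕ} (hm : 1 ≤ m) (hmn : m ≤ n)
    {T₀ : X →L[ℝ] Y} {T : PiLp p (fun _ : Fin m => X) →L[ℝ] PiLp q (fun _ : Fin m => Y)}
    (hT : ∀ x i, T x i = T₀ (x i)) (hp : p ≠ ∞) (hα : 0 ≤ 1 / p.toReal - 1 / q.toReal) {M : ℝ}
    (hM : ∀ k : ℕ, 1 ≤ k → k ≤ n → 1 / 16 * n / m ≤ (k : ℝ) →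
      ((k : ℝ) / n) ^ (1 / p.toReal - 1 / q.toReal) * entropyNum k T₀ ≤ M) :
    entropyNum n T ≤ 16 ^ (1 / p.toReal - 1 / q.toReal) * 17 ^ (1 / q.toReal) * M := by
  classical
  set α := 1 / p.toReal - 1 / q.toReal with hαdef
  have hn : 1 ≤ n := hm.trans hmn
  have hn' : (0 : ℝ) < n := by exact_mod_cast hn
  have hm' : (0 : ℝ) < m := by exact_mod_cast hm
  have hp0 : 0 < p.toReal := ENNReal.toReal_pos (zero_lt_one.trans_le Fact.out).ne' hp
  have hM0 : 0 ≤ M := by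
    refine le_trans ?_ (hM n hn le_rfl ?_)
    · exact mul_nonneg (by positivity) (entropyNum_nonneg _ _)
    · rw [div_le_iff₀ hm']
      have : (1 : ℝ) ≤ m := by exact_mod_cast hm
      nlinarith
  suffices H : ∀ η > 0, entropyNum n T ≤ 16 ^ α * 17 ^ (1 / q.toReal) * (M + η) by
    have hC : (0 : ℝ) < 16 ^ α * 17 ^ (1 / q.toReal) := by positivity
    rw [← div_le_iff₀' hC]
    exact le_of_forall_pos_le_add fun η hη => (div_le_iff₀' hC).2 (H η hη)
  intro η hη
  choose S hScard hScov using fun k =>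
    exists_cover_of_entropyNum_lt (lt_add_of_pos_right (entropyNum k T₀) hη)
  set N := n / 16
  set r := n / (16 * m)
  let σ : ℕ → ℝ := fun b => 16 * (b + 1) / n
  have hσ : ∀ b, 0 < σ b := fun b => by positivity
  have hmr : m * r ≤ N := by
    rw [Nat.le_div_iff_mul_le (by norm_num)]
    calc m * r * 16 = 16 * m * r := by ring
      _ ≤ n := Nat.mul_div_le _ _
  have hsum : ∀ b : Fin m → ℕ, ∑ i, b i ≤ N → ∑ i, (b i + r) ≤ 2 * N := fun b hb => by
    rw [Finset.sum_add_distrib, Finset.sum_const, Finset.card_univ, Fintype.card_fin, smul_eq_mul]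
    omega
  refine entropyNum_le (by positivity) ((latticeSimplex m N).biUnion fun b =>
    (Fintype.piFinset fun i => S (b i + r + 1)).image fun y =>
      WithLp.toLp q fun i => σ (b i) ^ (1 / p.toReal) • y i) ?_ ?_
  · refine (Finset.card_biUnion_le_card_mul _ _ (2 ^ (2 * N)) fun b hb => ?_).trans
      (card_latticeSimplex_mul_two_pow_le hmn)
    refine Finset.card_image_le.trans ?_
    rw [Fintype.card_piFinset]
    calc ∏ i, (S (b i + r + 1)).card ≤ ∏ i, 2 ^ (b i + r) :=
          Finset.prod_le_prod' fun i _ => hScard _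
      _ = 2 ^ ∑ i, (b i + r) := Finset.prod_pow_eq_pow_sum _ _ _
      _ ≤ 2 ^ (2 * N) := Nat.pow_le_pow_right (by norm_num) (hsum b (mem_latticeSimplex.1 hb))
  · intro x hx
    let b : Fin m → ℕ := fun i => ⌊n * ‖x i‖ ^ p.toReal / 16⌋₊
    have hx1 : ∑ i, ‖x i‖ ^ p.toReal ≤ 1 := by
      rw [PiLp.norm_eq_sum hp0, one_div, Real.rpow_inv_le_iff_of_pos (by positivity)
        zero_le_one hp0, Real.one_rpow] at hx
      exact hx
    have hbN : ∑ i, b i ≤ N := by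
      rw [Nat.le_div_iff_mul_le (by norm_num)]
      have : (∑ i, (b i : ℝ)) * 16 ≤ n := by
        calc (∑ i, (b i : ℝ)) * 16 ≤ (∑ i, n * ‖x i‖ ^ p.toReal / 16) * 16 := by
              gcongr with i
              exact Nat.floor_le (by positivity)
          _ = n * ∑ i, ‖x i‖ ^ p.toReal := by
              rw [← Finset.sum_div, Finset.mul_sum]
              ring
          _ ≤ n * 1 := by gcongr
          _ = n := mul_one _
      exact_mod_cast this
    have hxσ : ∀ i, ‖x i‖ ≤ σ (b i) ^ (1 / p.toReal) := by
      intro i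
      rw [one_div, Real.le_rpow_inv_iff_of_pos (norm_nonneg _) (hσ _).le hp0]
      have := (Nat.lt_floor_add_one (n * ‖x i‖ ^ p.toReal / 16)).le
      rw [le_div_iff₀ hn']
      change _ ≤ ((b i : ℝ) + 1) at this
      linarith
    have hscaled : ∀ i, ∃ y ∈ S (b i + r + 1),
        ‖T₀ (x i) - σ (b i) ^ (1 / p.toReal) • y‖ ≤
          σ (b i) ^ (1 / p.toReal) * (entropyNum (b i + r + 1) T₀ + η) := by
      intro i
      have hτ : 0 < σ (b i) ^ (1 / p.toReal) := Real.rpow_pos_of_pos (hσ _) _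
      set τ := σ (b i) ^ (1 / p.toReal)
      obtain ⟨y, hy, hxy⟩ := hScov (b i + r + 1) (τ⁻¹ • x i) (by
        rw [norm_smul, norm_inv, Real.norm_of_nonneg hτ.le, inv_mul_le_iff₀ hτ, mul_one]
        exact hxσ i)
      refine ⟨y, hy, ?_⟩
      have : T₀ (x i) - τ • y = τ • (T₀ (τ⁻¹ • x i) - y) := by
        rw [smul_sub, map_smul, smul_inv_smul₀ hτ.ne']
      rw [this, norm_smul, Real.norm_of_nonneg hτ.le]
      gcongr
    choose y hyS hy using hscaled
    refine ⟨WithLp.toLp q fun i => σ (b i) ^ (1 / p.toReal) • y i, ?_, ?_⟩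
    · exact Finset.mem_biUnion.2 ⟨b, mem_latticeSimplex.2 hbN, Finset.mem_image.2
        ⟨y, Fintype.mem_piFinset.2 hyS, rfl⟩⟩
    · rw [mul_right_comm]
      refine PiLp.norm_le_of_forall_norm_le_rpow (σ := fun i => σ (b i)) (by positivity)
        (fun i => (hσ _).le) ?_ fun i => ?_
      · have h₁ : (∑ i, (b i : ℝ)) * 16 ≤ n := by
          have : (∑ i, b i) * 16 ≤ n := by omega
          exact_mod_cast this
        have h₂ : (m : ℝ) ≤ n := by exact_mod_cast hmn
        simp only [σ]
        rw [← Finset.sum_div, ← Finset.mul_sum, Finset.sum_add_distrib, Finset.sum_const,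
          Finset.card_univ, Fintype.card_fin, nsmul_eq_mul, div_le_iff₀ hn']
        linarith
      · rw [PiLp.sub_apply, hT]
        refine (hy i).trans ?_
        have hb2 : b i + r ≤ 2 * N :=
          (Finset.single_le_sum (f := fun i => b i + r) (fun _ _ => Nat.zero_le _)
            (Finset.mem_univ i)).trans (hsum b hbN)
        set k := b i + r + 1 with hk
        have hkn : k ≤ n := by omega
        have hkm : 1 / 16 * n / m ≤ (k : ℝ) := by
          have h₁ : n ≤ 16 * m * k := by
            have := Nat.lt_mul_div_succ n (show 0 < 16 * m by omega)
            exact this.le.trans (Nat.mul_le_mul_left _ (by omega))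
          have h₂ : (n : ℝ) ≤ 16 * m * k := by exact_mod_cast h₁
          rw [div_le_iff₀ hm']
          linarith
        have he := entropyNum_nonneg k T₀
        have hkσ : σ (b i) / 16 ≤ (k : ℝ) / n := by
          simp only [σ, hk]
          rw [div_div, mul_comm (n : ℝ) 16, mul_div_mul_left _ _ (by norm_num)]
          gcongr
          push_cast
          linarith [Nat.cast_nonneg (α := ℝ) r]
        have hle : (σ (b i) / 16) ^ α * (entropyNum k T₀ + η) ≤ M + η := by
          have hk1 : ((k : ℝ) / n) ^ α ≤ 1 :=
            Real.rpow_le_one (by positivity) ((div_le_one hn').2 (by exact_mod_cast hkn)) hα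
          calc (σ (b i) / 16) ^ α * (entropyNum k T₀ + η)
              ≤ ((k : ℝ) / n) ^ α * (entropyNum k T₀ + η) := by
                have := (hσ (b i)).le
                gcongr
            _ = ((k : ℝ) / n) ^ α * entropyNum k T₀ + ((k : ℝ) / n) ^ α * η := mul_add _ _ _
            _ ≤ M + η := add_le_add (hM k (Nat.le_add_left 1 _) hkn hkm) (mul_le_of_le_one_left hη.le hk1)
        have hsplit : σ (b i) ^ (1 / p.toReal) =
            16 ^ α * (σ (b i) / 16) ^ α * σ (b i) ^ (1 / q.toReal) := by
          rw [← Real.mul_rpow (by norm_num) (by have := (hσ (b i)).le; positivity),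
            mul_div_cancel₀ _ (by norm_num), ← Real.rpow_add (hσ _), hαdef]
          ring_nf
        rw [hsplit]
        have := (hσ (b i)).le
        calc 16 ^ α * (σ (b i) / 16) ^ α * σ (b i) ^ (1 / q.toReal) * (entropyNum k T₀ + η)
            = 16 ^ α * ((σ (b i) / 16) ^ α * (entropyNum k T₀ + η)) * σ (b i) ^ (1 / q.toReal) := by
              ring
          _ ≤ _ := by gcongr

end Diagonal

/-- Theorem 3.3(ii): for `m ≤ n`, two-sided estimates for the entropy numbers of the
diagonal operator `T = (T₀, …, T₀) : ℓ_p^m(X) → ℓ_q^m(Y)` in terms of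
`D(a,n,m) = max_{k ∈ {1,…,n}, k ≥ a} (k/n)^α e_k(T₀)`, at `a = c₃ n/m` and `a = c₄ n/m`,
where `c₃, c₄` are absolute constants and `c₅, c₆` depend only on `p` and `q`. -/
theorem entropy_diagonal_small_m :
    ∃ c₃ c₄ : ℝ, 0 < c₃ ∧ 0 < c₄ ∧
      ∀ (p q : ℝ≥0∞) [Fact (1 ≤ p)] [Fact (1 ≤ q)], p < q →
        ∃ c₅ c₆ : ℝ, 0 < c₅ ∧ 0 < c₆ ∧
          ∀ (m n : ℕ) (hm : 1 ≤ m) (hmn : m ≤ n)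
            (X Y : Type) [NormedAddCommGroup X] [NormedSpace ℝ X]
            [NormedAddCommGroup Y] [NormedSpace ℝ Y]
            (T0 : X →L[ℝ] Y)
            (T : PiLp p (fun _ : Fin m => X) →L[ℝ] PiLp q (fun _ : Fin m => Y)),
            (∀ x i, T x i = T0 (x i)) →
            let D : ℝ → ℝ := fun a => sSup {x : ℝ | ∃ k : ℕ, 1 ≤ k ∧ k ≤ n ∧ a ≤ (k : ℝ) ∧
              x = ((k : ℝ) / n) ^ (1 / p.toReal - 1 / q.toReal) * entropyNum k T0}
            c₅ * D (c₃ * n / m) ≤ entropyNum n T ∧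
              entropyNum n T ≤ c₆ * D (c₄ * n / m) := by
  refine ⟨4, 1 / 16, by norm_num, by norm_num, fun p q _ _ hpq => ?_⟩
  have hp : p ≠ ∞ := hpq.ne_top
  have hα : 0 ≤ 1 / p.toReal - 1 / q.toReal := by
    have hp0 : 0 < p.toReal := ENNReal.toReal_pos (zero_lt_one.trans_le Fact.out).ne' hp
    rcases eq_or_ne q ∞ with rfl | hq
    · simp
    · exact sub_nonneg.2 (one_div_le_one_div_of_le hp0 (ENNReal.toReal_mono hq hpq.le))
  refine ⟨5 ^ (-(1 / p.toReal - 1 / q.toReal)) / 256,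
    16 ^ (1 / p.toReal - 1 / q.toReal) * 17 ^ (1 / q.toReal), by positivity, by positivity, ?_⟩
  intro m n hm hmn X Y _ _ _ _ T0 T hT D
  have hm' : (0 : ℝ) < m := by exact_mod_cast hm
  constructor
  · have hc : (0 : ℝ) < 5 ^ (-(1 / p.toReal - 1 / q.toReal)) / 256 := by positivity
    rw [← le_div_iff₀' hc]
    refine Real.sSup_le ?_ (div_nonneg (entropyNum_nonneg n T) hc.le)
    rintro _ ⟨k, hk, hkn, hkm, rfl⟩
    rw [le_div_iff₀' hc]
    rw [div_le_iff₀ hm'] at hkm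
    exact rpow_mul_entropyNum_le_entropyNum_diagonal hT hα hk hkn (by exact_mod_cast hkm)
  · refine entropyNum_diagonal_le hm hmn hT hp hα fun k hk hkn hkm =>
      le_csSup (Set.Finite.bddAbove ?_) ⟨k, hk, hkn, hkm, rfl⟩
    refine ((Set.finite_Icc 1 n).image fun k : ℕ =>
      ((k : ℝ) / n) ^ (1 / p.toReal - 1 / q.toReal) * entropyNum k T0).subset ?_
    rintro _ ⟨j, hj, hjn, -, rfl⟩
    exact ⟨j, ⟨hj, hjn⟩, rfl⟩
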